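/- Let (x*,λ*) be a saddle point of L, assume β(t) = μ e^{t/δ} with μ > 0 and γδ > 1, and let (x,λ) be a global solution of the primal-dual dynamical system. Then there exists C ≥ 0 such that |f(x(t)) − f(x*)| ≤ C e^{−t/δ} for all t ≥ t₀. -/

import Mathlib

open scoped RealInnerProductSpace
open MeasureTheory Set

noncomputable def Lagr {n m : ℕ} (f : EuclideanSpace ℝ (Fin n) → ℝ)
    (A : EuclideanSpace ℝ (Fin n) →L[ℝ] EuclideanSpace ℝ (Fin m))
    (b : EuclideanSpace ℝ (Fin m))
    (x : EuclideanSpace ℝ (Fin n)) (lam : EuclideanSpace ℝ (Fin m)) : ℝ :=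
  f x + ⟪lam, A x - b⟫

noncomputable def AugLagr {n m : ℕ} (f : EuclideanSpace ℝ (Fin n) → ℝ)
    (A : EuclideanSpace ℝ (Fin n) →L[ℝ] EuclideanSpace ℝ (Fin m))
    (b : EuclideanSpace ℝ (Fin m)) (σ : ℝ)
    (x : EuclideanSpace ℝ (Fin n)) (lam : EuclideanSpace ℝ (Fin m)) : ℝ :=
  Lagr f A b x lam + σ / 2 * ‖A x - b‖ ^ 2

def IsSaddlePoint {n m : ℕ} (f : EuclideanSpace ℝ (Fin n) → ℝ)
    (A : EuclideanSpace ℝ (Fin n) →L[ℝ] EuclideanSpace ℝ (Fin m))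
    (b : EuclideanSpace ℝ (Fin m))
    (xs : EuclideanSpace ℝ (Fin n)) (ls : EuclideanSpace ℝ (Fin m)) : Prop :=
  ∀ x lam, Lagr f A b xs lam ≤ Lagr f A b xs ls ∧ Lagr f A b xs ls ≤ Lagr f A b x ls

/-- The first-order lower bound for a differentiable convex function. -/
theorem ConvexOn.add_inner_gradient_le {E : Type*} [NormedAddCommGroup E] [InnerProductSpace ℝ E]
    [CompleteSpace E] {f : E → ℝ} (hf : ConvexOn ℝ univ f) {x : E}
    (hx : DifferentiableAt ℝ f x) (y : E) :
    f x + ⟪gradient f x, y - x⟫ ≤ f y := by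
  have hline : HasDerivAt (fun s : ℝ => AffineMap.lineMap x y s) (y - x) 0 :=
    AffineMap.hasDerivAt_lineMap
  have hx0 : HasFDerivAt f (InnerProductSpace.toDual ℝ E (gradient f x))
      (AffineMap.lineMap x y (0 : ℝ)) := by
    simpa using hx.hasGradientAt.hasFDerivAt
  have hconv : ConvexOn ℝ univ (f ∘ (AffineMap.lineMap x y : ℝ →ᵃ[ℝ] E)) := by
    simpa using hf.comp_affineMap (AffineMap.lineMap x y : ℝ →ᵃ[ℝ] E)
  have h := hconv.le_slope_of_hasDerivAt (mem_univ 0) (mem_univ 1) one_pos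
    (hx0.comp_hasDerivAt (0 : ℝ) hline)
  have hslope : slope (f ∘ (AffineMap.lineMap x y : ℝ →ᵃ[ℝ] E)) 0 1 = f y - f x := by
    simp [slope_def_field]
  rw [hslope, InnerProductSpace.toDual_apply_apply] at h
  linarith

theorem IsSaddlePoint.map_eq {n m : ℕ} {f : EuclideanSpace ℝ (Fin n) → ℝ}
    {A : EuclideanSpace ℝ (Fin n) →L[ℝ] EuclideanSpace ℝ (Fin m)}
    {b : EuclideanSpace ℝ (Fin m)}
    {xs : EuclideanSpace ℝ (Fin n)} {ls : EuclideanSpace ℝ (Fin m)}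
    (h : IsSaddlePoint f A b xs ls) : A xs = b := by
  have h1 := (h xs (ls + (A xs - b))).1
  simp only [Lagr, inner_add_left, real_inner_self_eq_norm_sq] at h1
  have h2 : ‖A xs - b‖ ^ 2 = 0 := le_antisymm (by linarith) (sq_nonneg _)
  exact sub_eq_zero.1 (norm_eq_zero.1 (pow_eq_zero_iff two_ne_zero |>.1 h2))

theorem IsSaddlePoint.le_lagr {n m : ℕ} {f : EuclideanSpace ℝ (Fin n) → ℝ}
    {A : EuclideanSpace ℝ (Fin n) →L[ℝ] EuclideanSpace ℝ (Fin m)}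
    {b : EuclideanSpace ℝ (Fin m)}
    {xs : EuclideanSpace ℝ (Fin n)} {ls : EuclideanSpace ℝ (Fin m)}
    (h : IsSaddlePoint f A b xs ls) (x : EuclideanSpace ℝ (Fin n)) :
    f xs ≤ Lagr f A b x ls := by
  simpa [Lagr, h.map_eq] using (h x ls).2

theorem HasDerivWithinAt.augLagr {n m : ℕ} {f : EuclideanSpace ℝ (Fin n) → ℝ}
    {A : EuclideanSpace ℝ (Fin n) →L[ℝ] EuclideanSpace ℝ (Fin m)}
    {b : EuclideanSpace ℝ (Fin m)} {σ : ℝ} {x : ℝ → EuclideanSpace ℝ (Fin n)}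
    {x' : EuclideanSpace ℝ (Fin n)} {s : Set ℝ} {t : ℝ}
    (hx : HasDerivWithinAt x x' s t) (hf : DifferentiableAt ℝ f (x t))
    (l : EuclideanSpace ℝ (Fin m)) :
    HasDerivWithinAt (fun t => AugLagr f A b σ (x t) l)
      (⟪gradient f (x t), x'⟫ + ⟪l, A x'⟫ + σ * ⟪A (x t) - b, A x'⟫) s t := by
  have hfx := hf.hasGradientAt.hasFDerivAt.comp_hasDerivWithinAt t hx
  have hAx : HasDerivWithinAt (fun t => A (x t) - b) (A x') s t :=
    (A.hasFDerivAt.comp_hasDerivWithinAt t hx).sub_const b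
  have hl := (hasDerivWithinAt_const t s l).inner ℝ hAx
  refine ((hfx.add hl).add (hAx.norm_sq.const_mul (σ / 2))).congr_deriv ?_
  rw [InnerProductSpace.toDual_apply_apply, inner_zero_left]
  ring

/-- The Lyapunov function of the primal-dual dynamical system. -/
noncomputable def primalDualEnergy {n m : ℕ} (f : EuclideanSpace ℝ (Fin n) → ℝ)
    (A : EuclideanSpace ℝ (Fin n) →L[ℝ] EuclideanSpace ℝ (Fin m))
    (b : EuclideanSpace ℝ (Fin m)) (γ δ σ β : ℝ)
    (xs : EuclideanSpace ℝ (Fin n)) (ls : EuclideanSpace ℝ (Fin m))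
    (x v : EuclideanSpace ℝ (Fin n)) (l : EuclideanSpace ℝ (Fin m)) : ℝ :=
  δ ^ 2 * (β * (AugLagr f A b σ x ls - f xs)) + 1 / 2 * ‖(x - xs) + δ • v‖ ^ 2
    + (γ * δ - 1) / 2 * ‖x - xs‖ ^ 2 + δ / 2 * ‖l - ls‖ ^ 2

/-- The value of the derivative of `primalDualEnergy` along the flow is nonpositive. -/
theorem primalDualEnergy_deriv_nonpos {n m : ℕ} {f : EuclideanSpace ℝ (Fin n) → ℝ}
    (hf_conv : ConvexOn ℝ univ f)
    {A : EuclideanSpace ℝ (Fin n) →L[ℝ] EuclideanSpace ℝ (Fin m)}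
    {b : EuclideanSpace ℝ (Fin m)} {γ δ σ β : ℝ} (hδ : 0 < δ) (hσ : 0 < σ) (hβ : 0 < β)
    (hγδ : 1 < γ * δ) {xs : EuclideanSpace ℝ (Fin n)} (hxs : A xs = b)
    (ls : EuclideanSpace ℝ (Fin m)) {x v a : EuclideanSpace ℝ (Fin n)}
    {l l' : EuclideanSpace ℝ (Fin m)} (hfx : DifferentiableAt ℝ f x)
    (ha : a + γ • v = -β • (gradient f x + A.adjoint l + σ • A.adjoint (A x - b)))
    (hl' : l' = β • (A (x + δ • v) - b)) :
    δ ^ 2 * (β / δ * (AugLagr f A b σ x ls - f xs)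
        + β * (⟪gradient f x, v⟫ + ⟪ls, A v⟫ + σ * ⟪A x - b, A v⟫))
      + 1 / 2 * (2 * ⟪(x - xs) + δ • v, v + δ • a⟫)
      + (γ * δ - 1) / 2 * (2 * ⟪x - xs, v⟫) + δ / 2 * (2 * ⟪l - ls, l'⟫) ≤ 0 := by
  have ha' : a = -β • (gradient f x + A.adjoint l + σ • A.adjoint (A x - b)) - γ • v :=
    eq_sub_of_add_eq ha
  obtain ⟨u, rfl⟩ : ∃ u, x = xs + u := ⟨x - xs, by abel⟩
  have hw : A (xs + u) - b = A u := by rw [map_add, hxs]; abel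
  have hw' : A (xs + u + δ • v) - b = A u + δ • A v := by
    rw [map_add, map_add, hxs, map_smul]; abel
  have hgrad := hf_conv.add_inner_gradient_le hfx xs
  have hu : xs - (xs + u) = -u := by abel
  have hu' : xs + u - xs = u := by abel
  rw [hu, inner_neg_right] at hgrad
  set g := gradient f (xs + u)
  rw [hl', hw', ha', hw, hu', AugLagr, Lagr, hw]
  simp only [inner_add_left, inner_add_right, inner_sub_left, inner_sub_right, inner_smul_left,
    inner_smul_right, ContinuousLinearMap.adjoint_inner_right, real_inner_self_eq_norm_sq,
    map_add, map_smul, smul_add, smul_sub, real_inner_comm g, real_inner_comm l,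
    real_inner_comm (A u) (A v), conj_trivial]
  have key : 0 ≤ δ * (γ * δ - 1) * ‖v‖ ^ 2 + δ * β * (σ / 2 * ‖A u‖ ^ 2)
      + δ * β * (f xs - (f (xs + u) - ⟪g, u⟫)) := by
    have h1 : 0 ≤ γ * δ - 1 := by linarith
    have h2 : 0 ≤ f xs - (f (xs + u) - ⟪g, u⟫) := by linarith
    positivity
  rw [← sub_nonneg]
  convert key using 1
  field_simp
  ring

theorem exponential_objective_rate
    {n m : ℕ}
    (f : EuclideanSpace ℝ (Fin n) → ℝ)
    (hf_conv : ConvexOn ℝ Set.univ f)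
    (hf_smooth : ContDiff ℝ 1 f)
    (A : EuclideanSpace ℝ (Fin n) →L[ℝ] EuclideanSpace ℝ (Fin m))
    (b : EuclideanSpace ℝ (Fin m))
    (t₀ γ δ σ : ℝ) (ht₀ : 0 ≤ t₀) (hγ : 0 < γ) (hδ : 0 < δ) (hσ : 0 < σ)
    (μ : ℝ) (hμ : 0 < μ) (hγδ : 1 < γ * δ)
    (β : ℝ → ℝ) (hβeq : ∀ t, β t = μ * Real.exp (t / δ))
    (xs : EuclideanSpace ℝ (Fin n)) (ls : EuclideanSpace ℝ (Fin m))
    (hsaddle : IsSaddlePoint f A b xs ls)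
    (x x' x'' : ℝ → EuclideanSpace ℝ (Fin n))
    (lam lam' : ℝ → EuclideanSpace ℝ (Fin m))
    (hx : ∀ t ∈ Ici t₀, HasDerivWithinAt x (x' t) (Ici t₀) t)
    (hx' : ∀ t ∈ Ici t₀, HasDerivWithinAt x' (x'' t) (Ici t₀) t)
    (hx''cont : ContinuousOn x'' (Ici t₀))
    (hlam : ∀ t ∈ Ici t₀, HasDerivWithinAt lam (lam' t) (Ici t₀) t)
    (hlam'cont : ContinuousOn lam' (Ici t₀))
    (hode1 : ∀ t ∈ Ici t₀, x'' t + γ • x' t =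
      -(β t) • (gradient f (x t) + A.adjoint (lam t) + σ • A.adjoint (A (x t) - b)))
    (hode2 : ∀ t ∈ Ici t₀, lam' t = β t • (A (x t + δ • x' t) - b))
    :
    ∃ C : ℝ, 0 ≤ C ∧ ∀ t ∈ Ici t₀, |f (x t) - f xs| ≤ C * Real.exp (-t / δ) := by
  have hf_diff : Differentiable ℝ f := hf_smooth.differentiable one_ne_zero
  have hAxs := hsaddle.map_eq
  have hβpos (t : ℝ) : 0 < β t := by rw [hβeq]; positivity
  have hβ' (t : ℝ) : HasDerivWithinAt β (β t / δ) (Ici t₀) t := by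
    have h : HasDerivAt (fun t => μ * Real.exp (t / δ)) (μ * (Real.exp (t / δ) * (1 / δ))) t :=
      (((hasDerivAt_id t).div_const δ).exp).const_mul μ
    rw [funext hβeq]
    refine h.hasDerivWithinAt.congr_deriv ?_
    ring
  set E : ℝ → ℝ := fun t => primalDualEnergy f A b γ δ σ (β t) xs ls (x t) (x' t) (lam t) with hE
  have hE_deriv (t : ℝ) (ht : t ∈ Ici t₀) := (((((hβ' t).mul
    (((hx t ht).augLagr (A := A) (b := b) (σ := σ) (hf_diff (x t)) ls).sub_const (f xs))).const_mul
      (δ ^ 2)).add (((((hx t ht).sub_const xs).add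
        ((hx' t ht).const_smul δ)).norm_sq).const_mul (1 / 2))).add
      (((hx t ht).sub_const xs).norm_sq.const_mul ((γ * δ - 1) / 2))).add
      (((hlam t ht).sub_const ls).norm_sq.const_mul (δ / 2))
  have hE_anti : AntitoneOn E (Ici t₀) :=
    antitoneOn_of_hasDerivWithinAt_nonpos (convex_Ici t₀)
      (fun t ht => (hE_deriv t ht).continuousWithinAt)
      (fun t ht => (hE_deriv t (interior_subset ht)).mono interior_subset)
      (fun t ht => primalDualEnergy_deriv_nonpos hf_conv hδ hσ (hβpos t) hγδ hAxs ls
        (hf_diff (x t)) (hode1 t (interior_subset ht)) (hode2 t (interior_subset ht)))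
  have hgap (t : ℝ) : 0 ≤ AugLagr f A b σ (x t) ls - f xs := by
    have h1 := hsaddle.le_lagr (x t)
    have h2 : 0 ≤ σ / 2 * ‖A (x t) - b‖ ^ 2 := by positivity
    rw [AugLagr]
    linarith
  have hcoef : 0 ≤ γ * δ - 1 := by linarith
  have hE_gap (t : ℝ) (ht : t ∈ Ici t₀) :
      δ ^ 2 * (β t * (AugLagr f A b σ (x t) ls - f xs)) ≤ E t₀ := by
    refine le_trans ?_ (hE_anti self_mem_Ici ht ht)
    simp only [hE, primalDualEnergy, add_assoc]
    exact le_add_of_nonneg_right (by positivity)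
  have hE_dual (t : ℝ) (ht : t ∈ Ici t₀) : δ / 2 * ‖lam t - ls‖ ^ 2 ≤ E t₀ := by
    refine le_trans ?_ (hE_anti self_mem_Ici ht ht)
    have h1 := hgap t
    have h2 := hβpos t
    simp only [hE, primalDualEnergy]
    exact le_add_of_nonneg_left (by positivity)
  -- The quantity `δ β (A x - b) - λ` is conserved along the flow.
  set c : ℝ → EuclideanSpace ℝ (Fin m) := fun t => (δ * β t) • (A (x t) - b) - lam t with hc
  have hc_deriv (t : ℝ) (ht : t ∈ Ici t₀) : HasDerivWithinAt c 0 (Ici t₀) t := by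
    have hAx : HasDerivWithinAt (fun t => A (x t) - b) (A (x' t)) (Ici t₀) t :=
      (A.hasFDerivAt.comp_hasDerivWithinAt t (hx t ht)).sub_const b
    refine ((((hβ' t).const_mul δ).smul hAx).sub (hlam t ht)).congr_deriv ?_
    rw [hode2 t ht, mul_div_cancel₀ _ hδ.ne', map_add, map_smul]
    module
  have hc_const (t : ℝ) (ht : t ∈ Ici t₀) : c t = c t₀ :=
    constant_of_has_deriv_right_zero
      (fun s hs => (hc_deriv s hs.1).continuousWithinAt.mono Icc_subset_Ici_self)
      (fun s hs => (hc_deriv s hs.1).mono (Ici_subset_Ici.2 hs.1)) t ⟨ht, le_rfl⟩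
  have hE0 : 0 ≤ E t₀ := le_trans (by positivity) (hE_dual t₀ self_mem_Ici)
  set K : ℝ := √(2 * E t₀ / δ) + ‖ls + c t₀‖
  have hfeas (t : ℝ) (ht : t ∈ Ici t₀) : δ * β t * ‖A (x t) - b‖ ≤ K := by
    have h1 : ‖lam t - ls‖ ≤ √(2 * E t₀ / δ) := by
      refine Real.le_sqrt_of_sq_le ?_
      rw [le_div_iff₀ hδ]
      linarith [hE_dual t ht]
    have h2 : (δ * β t) • (A (x t) - b) = (lam t - ls) + (ls + c t₀) := by
      rw [← hc_const t ht, ← add_assoc, sub_add_cancel, add_sub_cancel]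
    have h3 := hβpos t
    calc δ * β t * ‖A (x t) - b‖ = ‖(δ * β t) • (A (x t) - b)‖ := by
          rw [norm_smul, Real.norm_of_nonneg (by positivity)]
      _ ≤ ‖lam t - ls‖ + ‖ls + c t₀‖ := h2 ▸ norm_add_le _ _
      _ ≤ K := add_le_add h1 le_rfl
  refine ⟨(E t₀ / δ ^ 2 + ‖ls‖ * (K / δ)) / μ, by positivity, fun t ht => ?_⟩
  have hsplit : |f (x t) - f xs| ≤
      (AugLagr f A b σ (x t) ls - f xs) + ‖ls‖ * ‖A (x t) - b‖ := by
    have h1 := abs_le.1 (abs_real_inner_le_norm ls (A (x t) - b))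
    have h2 := hsaddle.le_lagr (x t)
    have h3 : 0 ≤ σ / 2 * ‖A (x t) - b‖ ^ 2 := by positivity
    rw [AugLagr]
    rw [Lagr] at h2 ⊢
    exact abs_le.2 ⟨by linarith, by linarith⟩
  have hgap_le : β t * (AugLagr f A b σ (x t) ls - f xs) ≤ E t₀ / δ ^ 2 := by
    rw [le_div_iff₀' (by positivity)]
    exact hE_gap t ht
  have hfeas_le : β t * ‖A (x t) - b‖ ≤ K / δ := by
    rw [le_div_iff₀' hδ, ← mul_assoc]
    exact hfeas t ht
  have hmain : β t * |f (x t) - f xs| ≤ E t₀ / δ ^ 2 + ‖ls‖ * (K / δ) := by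
    calc β t * |f (x t) - f xs|
        ≤ β t * ((AugLagr f A b σ (x t) ls - f xs) + ‖ls‖ * ‖A (x t) - b‖) :=
          mul_le_mul_of_nonneg_left hsplit (hβpos t).le
      _ = β t * (AugLagr f A b σ (x t) ls - f xs) + ‖ls‖ * (β t * ‖A (x t) - b‖) := by ring
      _ ≤ _ := by gcongr
  calc |f (x t) - f xs| ≤ (E t₀ / δ ^ 2 + ‖ls‖ * (K / δ)) / β t := by
        rwa [le_div_iff₀' (hβpos t)]
    _ = _ := by rw [hβeq, neg_div, Real.exp_neg, ← div_div, div_eq_mul_inv _ (Real.exp _)]
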